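/- Let A be a finite Taylor algebra and let ρ, σ ∈ Con(A) be meet-irreducible. If ρ and σ are adjacent, i.e., there exists a reflexive good bridge from (A,ρ) to (A,σ), then Opt(ρ) = Opt(σ). -/

import Mathlib

namespace Zhuk

/-- A signature: a type of operation symbols with arities. -/
structure Signature where
  ops : Type
  arity : ops → ℕ

/-- An algebra structure of signature `S` on carrier `A`. -/
class SAlg (S : Signature) (A : Type) where
  interp : (o : S.ops) → (Fin (S.arity o) → A) → A

variable {S : Signature}

/-- Componentwise algebra structure on a product. -/
instance prodSAlg {A B : Type} [SAlg S A] [SAlg S B] : SAlg S (A × B) :=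
  ⟨fun o x => (SAlg.interp o fun i => (x i).1, SAlg.interp o fun i => (x i).2)⟩

/-- A subset closed under all the operations. -/
def IsSubuniverse (S : Signature) {A : Type} [SAlg S A] (R : Set A) : Prop :=
  ∀ (o : S.ops) (x : Fin (S.arity o) → A), (∀ i, x i ∈ R) → SAlg.interp o x ∈ R

/-- The algebra structure on (the subtype of) a subuniverse. -/
def subAlg {A : Type} [SAlg S A] (R : Set A) (h : IsSubuniverse S R) : SAlg S ↥R :=
  ⟨fun o x => ⟨SAlg.interp o fun i => (x i).1, h o _ fun i => (x i).2⟩⟩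

/-- Terms of signature `S` in `n` variables. -/
inductive STerm (S : Signature) (n : ℕ) : Type
  | var : Fin n → STerm S n
  | app (o : S.ops) : (Fin (S.arity o) → STerm S n) → STerm S n

/-- Evaluation of a term in an algebra. -/
def STerm.eval {A : Type} [SAlg S A] {n : ℕ} : STerm S n → (Fin n → A) → A
  | .var i, v => v i
  | .app o ts, v => SAlg.interp o fun i => (ts i).eval v

/-- The diagonal (smallest) congruence `0_A`. -/
def diag (A : Type) : Set (A × A) := {p | p.1 = p.2}

/-- Relational composition. -/
def rcomp {A B C : Type} (R : Set (A × B)) (T : Set (B × C)) : Set (A × C) :=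
  {p | ∃ b, (p.1, b) ∈ R ∧ (b, p.2) ∈ T}

/-- Relational inverse. -/
def rinv {A B : Type} (R : Set (A × B)) : Set (B × A) := {p | (p.2, p.1) ∈ R}

/-- Transitive closure of a binary relation (as a set of pairs). -/
def transCl {A : Type} (R : Set (A × A)) : Set (A × A) :=
  {p | Relation.TransGen (fun a b => (a, b) ∈ R) p.1 p.2}

/-- `R` is stable under (saturated with respect to) `ρ`:  `R = ρ ∘ R ∘ ρ`. -/
def Saturated {A : Type} (ρ R : Set (A × A)) : Prop := rcomp ρ (rcomp R ρ) = R

/-- A congruence: a subuniverse of `A²` which is an equivalence relation. -/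
def IsCongruence (S : Signature) {A : Type} [SAlg S A] (θ : Set (A × A)) : Prop :=
  IsSubuniverse S θ ∧ Equivalence fun a b => (a, b) ∈ θ

/-- `ρ ∈ Con*(A)`: a congruence different from the full congruence `1_A`. -/
def ConStar (S : Signature) {A : Type} [SAlg S A] (ρ : Set (A × A)) : Prop :=
  IsCongruence S ρ ∧ ρ ≠ Set.univ

/-- The ternary centralizer relation `C(φ, θ; δ)`, via the term condition. -/
def Centralizes (S : Signature) {A : Type} [SAlg S A] (φ θ δ : Set (A × A)) : Prop :=
  ∀ (n : ℕ) (t : STerm S (n + 1)) (a b : A) (c d : Fin n → A),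
    (a, b) ∈ φ → (∀ i, (c i, d i) ∈ θ) →
    (t.eval (Fin.cons a c), t.eval (Fin.cons a d)) ∈ δ →
    (t.eval (Fin.cons b c), t.eval (Fin.cons b d)) ∈ δ

/-- The centralizer `(δ : θ)`: the largest congruence `φ` with `C(φ, θ; δ)`. -/
def centralizer (S : Signature) {A : Type} [SAlg S A] (δ θ : Set (A × A)) : Set (A × A) :=
  ⋃₀ {φ | IsCongruence S φ ∧ Centralizes S φ θ δ}

/-- A congruence of the subalgebra `A(θ) ≤ A²`, viewed ambiently as a subset of
`(A×A) × (A×A)` whose field is `θ`. -/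
def IsConOn (S : Signature) {A : Type} [SAlg S A] (θ : Set (A × A))
    (Δ : Set ((A × A) × (A × A))) : Prop :=
  Δ ⊆ θ ×ˢ θ ∧ IsSubuniverse S Δ ∧ (∀ p ∈ θ, (p, p) ∈ Δ) ∧
    (∀ p q, (p, q) ∈ Δ → (q, p) ∈ Δ) ∧ (∀ p q r, (p, q) ∈ Δ → (q, r) ∈ Δ → (p, r) ∈ Δ)

/-- `Δ_{θ,α}`: the congruence of `A(θ)` generated by `{((a,a),(b,b)) : (a,b) ∈ α}`. -/
def DeltaCon (S : Signature) {A : Type} [SAlg S A] (θ α : Set (A × A)) :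
    Set ((A × A) × (A × A)) :=
  ⋂₀ {Δ | IsConOn S θ Δ ∧ ∀ a b : A, (a, b) ∈ α → ((a, a), (b, b)) ∈ Δ}

/-- Projection of a quaternary relation to its first two coordinates. -/
def pr12 {A B : Type} (T : Set (A × A × B × B)) : Set (A × A) :=
  {p | ∃ b₁ b₂, (p.1, p.2, b₁, b₂) ∈ T}

/-- Projection of a quaternary relation to its last two coordinates. -/
def pr34 {A B : Type} (T : Set (A × A × B × B)) : Set (B × B) :=
  {q | ∃ a₁ a₂, (a₁, a₂, q.1, q.2) ∈ T}

/-- The trace of a quaternary relation. -/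
def btr {A B : Type} (T : Set (A × A × B × B)) : Set (A × B) :=
  {p | (p.1, p.1, p.2, p.2) ∈ T}

/-- Zhuk's bridges: Definition 4.3 (B0*), (B1*), (B2*). -/
def IsBridge (S : Signature) {A B : Type} [SAlg S A] [SAlg S B]
    (ρ : Set (A × A)) (σ : Set (B × B)) (T : Set (A × A × B × B)) : Prop :=
  IsSubuniverse S T ∧
  (∀ a₁ a₂ b₁ b₂ a₁' a₂', (a₁, a₂, b₁, b₂) ∈ T → (a₁, a₁') ∈ ρ → (a₂, a₂') ∈ ρ →
    (a₁', a₂', b₁, b₂) ∈ T) ∧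
  (∀ a₁ a₂ b₁ b₂ b₁' b₂', (a₁, a₂, b₁, b₂) ∈ T → (b₁, b₁') ∈ σ → (b₂, b₂') ∈ σ →
    (a₁, a₂, b₁', b₂') ∈ T) ∧
  ρ ⊂ pr12 T ∧ σ ⊂ pr34 T ∧
  (∀ a₁ a₂ b₁ b₂, (a₁, a₂, b₁, b₂) ∈ T → ((a₁, a₂) ∈ ρ ↔ (b₁, b₂) ∈ σ))

/-- A bridge from `(A,ρ,L)` to `(B,σ,R)`: a bridge with prescribed anchors. -/
def IsBridgeLR (S : Signature) {A B : Type} [SAlg S A] [SAlg S B]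
    (ρ : Set (A × A)) (σ : Set (B × B)) (L : Set (A × A)) (R : Set (B × B))
    (T : Set (A × A × B × B)) : Prop :=
  IsBridge S ρ σ T ∧ pr12 T = L ∧ pr34 T = R

/-- A reflexive bridge (case `B = A`): `0_A ⊆ tr(T)`. -/
def ReflBridge {A : Type} (T : Set (A × A × A × A)) : Prop :=
  ∀ a : A, (a, a) ∈ btr T

/-- `Cov(ρ)`: the inclusion-minimal ρ-saturated subuniverses of `A²` properly containing ρ. -/
def Cov (S : Signature) {A : Type} [SAlg S A] (ρ : Set (A × A)) : Set (Set (A × A)) :=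
  {L | IsSubuniverse S L ∧ Saturated ρ L ∧ ρ ⊂ L ∧
    ∀ L', IsSubuniverse S L' → Saturated ρ L' → ρ ⊂ L' → L' ⊆ L → L' = L}

/-- `ref.tr(ρ,L)`: traces of reflexive bridges from `(A,ρ,L)` to itself. -/
def refTr (S : Signature) {A : Type} [SAlg S A] (ρ L : Set (A × A)) : Set (Set (A × A)) :=
  {γ | ∃ T : Set (A × A × A × A), IsBridgeLR S ρ ρ L L T ∧ ReflBridge T ∧ btr T = γ}

/-- `γ = Opt(ρ,L)`: `γ` is the (unique) inclusion-maximal member of `ref.tr(ρ,L)`. -/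
def IsOptOf (S : Signature) {A : Type} [SAlg S A] (ρ L γ : Set (A × A)) : Prop :=
  γ ∈ refTr S ρ L ∧ ∀ δ ∈ refTr S ρ L, γ ⊆ δ → δ = γ

/-- `ρ` is meet-irreducible with unique upper cover `ρplus`. -/
def MeetIrredWith (S : Signature) {A : Type} [SAlg S A] (ρ ρplus : Set (A × A)) : Prop :=
  IsCongruence S ρ ∧ ρ ≠ Set.univ ∧ IsCongruence S ρplus ∧ ρ ⊂ ρplus ∧
    ∀ θ, IsCongruence S θ → ρ ⊂ θ → ρplus ⊆ θ

/-- `Cov⁺(ρ) = {τ ∈ Cov(ρ) : τ ⊆ ρ⁺}`. -/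
def CovPlus (S : Signature) {A : Type} [SAlg S A] (ρ ρplus : Set (A × A)) :
    Set (Set (A × A)) :=
  {τ | τ ∈ Cov S ρ ∧ τ ⊆ ρplus}

/-- A good bridge between meet-irreducible congruences with upper covers `ρplus`, `σplus`. -/
def GoodBridge (S : Signature) {A B : Type} [SAlg S A] [SAlg S B]
    (ρ ρplus : Set (A × A)) (σ σplus : Set (B × B)) (T : Set (A × A × B × B)) : Prop :=
  IsBridge S ρ σ T ∧
    ∃ τ ∈ CovPlus S ρ ρplus, ∃ τ' ∈ CovPlus S σ σplus, ∃ T' ⊆ T,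
      IsBridgeLR S ρ σ τ τ' T' ∧ btr T' = btr T

/-- `t` (with Taylor-identity data `u v`) is idempotent on `A` and satisfies the
corresponding identities on `A`. -/
def TaylorOn (S : Signature) (A : Type) [SAlg S A] {n : ℕ} (t : STerm S n)
    (u v : Fin n → Fin n → Fin 2) : Prop :=
  (∀ a : A, t.eval (fun _ => a) = a) ∧
    ∀ (i : Fin n) (x y : A),
      t.eval (fun j => if u i j = 0 then x else y) =
        t.eval (fun j => if v i j = 0 then x else y)

/-- `A` is a Taylor algebra. -/
def IsTaylorAlg (S : Signature) (A : Type) [SAlg S A] : Prop :=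
  ∃ (n : ℕ) (t : STerm S n) (u v : Fin n → Fin n → Fin 2),
    1 < n ∧ (∀ i, u i i ≠ v i i) ∧ TaylorOn S A t u v

/-- `A` and `B` lie in a common (locally finite, as they are finite) Taylor variety:
they share a common Taylor term with common Taylor identities. -/
def CommonTaylor (S : Signature) (A B : Type) [SAlg S A] [SAlg S B] : Prop :=
  ∃ (n : ℕ) (t : STerm S n) (u v : Fin n → Fin n → Fin 2),
    1 < n ∧ (∀ i, u i i ≠ v i i) ∧ TaylorOn S A t u v ∧ TaylorOn S B t u v

/-- The quotient of `A` by (the equivalence relation of) `θ`. -/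
abbrev ConQuot {A : Type} (θ : Set (A × A)) : Type :=
  Quot (fun a b => (a, b) ∈ θ)

/-- The class of `a` in `A/θ`. -/
def ConQuot.mk {A : Type} (θ : Set (A × A)) (a : A) : ConQuot θ :=
  Quot.mk _ a

/-- The quotient algebra structure on `A/θ` (extensionally correct when `θ` is a
congruence). -/
noncomputable def quotAlg {S : Signature} {A : Type} (iA : SAlg S A) (θ : Set (A × A)) :
    SAlg S (ConQuot θ) :=
  ⟨fun o x => ConQuot.mk θ
    (@SAlg.interp S A iA o fun i => Classical.choose (Quot.exists_rep (x i)))⟩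

/-- `f` is a homomorphism with respect to the given algebra structures. -/
def IsHomI {S : Signature} {A B : Type} (iA : SAlg S A) (iB : SAlg S B) (f : A → B) : Prop :=
  ∀ (o : S.ops) (x : Fin (S.arity o) → A),
    f (@SAlg.interp S A iA o x) = @SAlg.interp S B iB o fun i => f (x i)

/-- The two algebras are isomorphic. -/
def IsoAlgI {S : Signature} {A B : Type} (iA : SAlg S A) (iB : SAlg S B) : Prop :=
  ∃ f : A ≃ B, IsHomI iA iB f

/-- The identity bridge `I_{(A,ρ,L)}`. -/
def idBridge {A : Type} (ρ L : Set (A × A)) : Set (A × A × A × A) :=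
  {p | (p.1, p.2.1) ∈ L ∧ (p.2.2.1, p.2.2.2) ∈ L ∧ (p.1, p.2.2.1) ∈ ρ ∧ (p.2.1, p.2.2.2) ∈ ρ}

/-- Composition of quaternary relations (bridges). -/
def bComp {A B C : Type} (T : Set (A × A × B × B)) (T' : Set (B × B × C × C)) :
    Set (A × A × C × C) :=
  {p | ∃ b₁ b₂, (p.1, p.2.1, b₁, b₂) ∈ T ∧ (b₁, b₂, p.2.2.1, p.2.2.2) ∈ T'}

/-- Converse of a quaternary relation (bridge). -/
def bConv {A B : Type} (T : Set (A × A × B × B)) : Set (B × B × A × A) :=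
  {p | (p.2.2.1, p.2.2.2, p.1, p.2.1) ∈ T}

/-- `Δ♭_{θ,α}`: the congruence `Δ_{θ,α}` of `A(θ)` viewed as a quaternary relation. -/
def deltaFlat (S : Signature) {A : Type} [SAlg S A] (θ α : Set (A × A)) :
    Set (A × A × A × A) :=
  {p | ((p.1, p.2.1), (p.2.2.1, p.2.2.2)) ∈ DeltaCon S θ α}

/-- `T^opt_{(A,ρ)} = I_{(A,ρ,ρ⁺)} ∘ Δ♭_{ρ⁺,(ρ:ρ⁺)} ∘ I_{(A,ρ,ρ⁺)}`. -/
def Topt (S : Signature) {A : Type} [SAlg S A] (ρ ρplus : Set (A × A)) :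
    Set (A × A × A × A) :=
  bComp (idBridge ρ ρplus)
    (bComp (deltaFlat S ρplus (centralizer S ρ ρplus)) (idBridge ρ ρplus))

/-- `A` is subdirectly irreducible with monolith `μ`. -/
def IsMonolith (S : Signature) {A : Type} [SAlg S A] (μ : Set (A × A)) : Prop :=
  IsCongruence S μ ∧ μ ≠ diag A ∧ ∀ θ, IsCongruence S θ → θ ≠ diag A → μ ⊆ θ

/-- The carrier of `D(A,θ)`-style quotients: `A(μ)/Δ_{μ,α}`. -/
abbrev DCar (S : Signature) (A : Type) [SAlg S A] (μ α : Set (A × A)) : Type :=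
  Quot (fun p q : ↥μ => ((p : A × A), (q : A × A)) ∈ DeltaCon S μ α)

/-- The class of a pair `p ∈ μ` in `A(μ)/Δ_{μ,α}`. -/
def DCar.mk (S : Signature) (A : Type) [SAlg S A] (μ α : Set (A × A)) (p : ↥μ) :
    DCar S A μ α :=
  Quot.mk _ p

/-- The algebra structure on `A(μ)/Δ_{μ,α}` (extensionally correct when `μ` is a
congruence and `Δ_{μ,α}` is a congruence of `A(μ)`). -/
noncomputable def DAlg (S : Signature) (A : Type) [SAlg S A] (μ α : Set (A × A))
    (h : IsSubuniverse S μ) : SAlg S (DCar S A μ α) :=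
  letI := subAlg μ h
  ⟨fun o x => DCar.mk S A μ α
    (SAlg.interp o fun i => Classical.choose (Quot.exists_rep (x i)))⟩

/-- The canonical similarity bridge `T_{D(A)}` from `A` to `D(A)`. -/
def TDBridge (S : Signature) (A : Type) [SAlg S A] (μ α : Set (A × A)) :
    Set (A × A × DCar S A μ α × DCar S A μ α) :=
  {x | ∃ (a b e : A) (_ : (a, b) ∈ μ) (h1 : (a, e) ∈ μ) (h2 : (b, e) ∈ μ),
    x = (a, b, DCar.mk S A μ α ⟨(a, e), h1⟩, DCar.mk S A μ α ⟨(b, e), h2⟩)}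

/-- Similarity of (subdirectly irreducible) algebras: `D(A) ≅ D(B)`, where `D(X)` is
`X(μ)/Δ_{μ,(0:μ)}` if the monolith `μ` is abelian, and `X` itself otherwise. -/
def SimilarI (S : Signature) {A B : Type} (iA : SAlg S A) (iB : SAlg S B) : Prop :=
  letI := iA
  letI := iB
  ∃ (μA : Set (A × A)) (μB : Set (B × B)) (hA : IsMonolith S μA) (hB : IsMonolith S μB),
    ((Centralizes S μA μA (diag A) ∧ Centralizes S μB μB (diag B)) →
      IsoAlgI (DAlg S A μA (centralizer S (diag A) μA) hA.1.1)
        (DAlg S B μB (centralizer S (diag B) μB) hB.1.1)) ∧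
    ((Centralizes S μA μA (diag A) ∧ ¬ Centralizes S μB μB (diag B)) →
      IsoAlgI (DAlg S A μA (centralizer S (diag A) μA) hA.1.1) iB) ∧
    ((¬ Centralizes S μA μA (diag A) ∧ Centralizes S μB μB (diag B)) →
      IsoAlgI iA (DAlg S B μB (centralizer S (diag B) μB) hB.1.1)) ∧
    ((¬ Centralizes S μA μA (diag A) ∧ ¬ Centralizes S μB μB (diag B)) →
      IsoAlgI iA iB)

end Zhuk

namespace Zhuk

variable {S : Signature}

section Polynomials

variable {Q : Type} [SAlg S Q]

/-- Unary polynomial operations of an algebra. -/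
inductive UPoly (S : Signature) {Q : Type} [SAlg S Q] : (Q → Q) → Prop
  | id : UPoly S fun x => x
  | const (c : Q) : UPoly S fun _ => c
  | app (o : S.ops) (f : Fin (S.arity o) → Q → Q) (hf : ∀ i, UPoly S (f i)) :
      UPoly S fun x => SAlg.interp o fun i => f i x

theorem UPoly.comp {f g : Q → Q} (hf : UPoly S f) (hg : UPoly S g) :
    UPoly S fun x => f (g x) := by
  induction hf with
  | id => exact hg
  | const c => exact UPoly.const c
  | app o f _ ih => exact UPoly.app o (fun i x => f i (g x)) ih

theorem UPoly.iterate {f : Q → Q} (hf : UPoly S f) (k : ℕ) : UPoly S f^[k] := by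
  induction k with
  | zero => exact UPoly.id
  | succ k ih => exact ih.comp hf

theorem UPoly.eval {n : ℕ} (t : STerm S n) {f : Fin n → Q → Q} (hf : ∀ i, UPoly S (f i)) :
    UPoly S fun x => t.eval fun i => f i x := by
  induction t with
  | var i => exact hf i
  | app o ts ih => exact UPoly.app o _ ih

theorem UPoly.mem_of_refl {f : Q → Q} (hf : UPoly S f) {R : Set (Q × Q)}
    (hR : IsSubuniverse S R) (hrefl : ∀ x, (x, x) ∈ R) {x y : Q} (h : (x, y) ∈ R) :
    (f x, f y) ∈ R := by
  induction hf with
  | id => exact h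
  | const c => exact hrefl c
  | app o f _ ih => exact hR o (fun i => (f i x, f i y)) ih

theorem UPoly.mem_of_refl_four {f : Q → Q} (hf : UPoly S f) {W : Set (Q × Q × Q × Q)}
    (hW : IsSubuniverse S W) (hrefl : ∀ x, (x, x, x, x) ∈ W) {x y z w : Q}
    (h : (x, y, z, w) ∈ W) : (f x, f y, f z, f w) ∈ W := by
  induction hf with
  | id => exact h
  | const c => exact hrefl c
  | app o f _ ih => exact hW o (fun i => (f i x, f i y, f i z, f i w)) ih

theorem STerm.eval_mem_two {n : ℕ} (t : STerm S n) {R : Set (Q × Q)}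
    (hR : IsSubuniverse S R) {x y : Fin n → Q} (h : ∀ i, (x i, y i) ∈ R) :
    (t.eval x, t.eval y) ∈ R := by
  induction t with
  | var i => exact h i
  | app o ts ih => exact hR o (fun i => ((ts i).eval x, (ts i).eval y)) ih

theorem STerm.eval_mem_four {n : ℕ} (t : STerm S n) {W : Set (Q × Q × Q × Q)}
    (hW : IsSubuniverse S W) {x y z w : Fin n → Q} (h : ∀ i, (x i, y i, z i, w i) ∈ W) :
    (t.eval x, t.eval y, t.eval z, t.eval w) ∈ W := by
  induction t with
  | var i => exact h i
  | app o ts ih =>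
    exact hW o (fun i => ((ts i).eval x, (ts i).eval y, (ts i).eval z, (ts i).eval w)) ih

/-- The equivalence closure of a reflexive subuniverse is a congruence. -/
theorem isCongruence_eqvGen {R : Set (Q × Q)} (hR : IsSubuniverse S R)
    (hrefl : ∀ x, (x, x) ∈ R) :
    IsCongruence S {p : Q × Q | Relation.EqvGen (fun a b => (a, b) ∈ R) p.1 p.2} := by
  classical
  refine ⟨?_, ⟨Relation.EqvGen.refl, fun h => Relation.EqvGen.symm _ _ h,
    fun h h' => Relation.EqvGen.trans _ _ _ h h'⟩⟩
  intro o z hz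
  have one : ∀ (c : Fin (S.arity o) → Q) (i : Fin (S.arity o)) (u v : Q),
      Relation.EqvGen (fun a b => (a, b) ∈ R) u v →
      Relation.EqvGen (fun a b => (a, b) ∈ R) (SAlg.interp o (Function.update c i u))
        (SAlg.interp o (Function.update c i v)) := by
    intro c i u v h
    induction h with
    | rel u v h =>
      refine Relation.EqvGen.rel _ _
        (hR o (fun j => (Function.update c i u j, Function.update c i v j)) fun j => ?_)
      by_cases hj : j = i
      · subst hj; simpa using h
      · simpa [hj] using hrefl (c j)
    | refl u => exact Relation.EqvGen.refl _
    | symm u v _ ih => exact Relation.EqvGen.symm _ _ ih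
    | trans u v w _ _ ih ih' => exact Relation.EqvGen.trans _ _ _ ih ih'
  have key : ∀ s : Finset (Fin (S.arity o)), Relation.EqvGen (fun a b => (a, b) ∈ R)
      (SAlg.interp o fun i => (z i).1)
      (SAlg.interp o fun i => if i ∈ s then (z i).2 else (z i).1) := by
    intro s
    induction s using Finset.induction_on with
    | empty => simpa using Relation.EqvGen.refl _
    | insert i s hi ih =>
      refine Relation.EqvGen.trans _ _ _ ih ?_
      have h := one (fun i => if i ∈ s then (z i).2 else (z i).1) i _ _ (hz i)
      convert h using 2 <;> funext j <;> by_cases hj : j = i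
      · subst hj; simp [hi]
      · simp [hj]
      · subst hj; simp
      · simp [hj]
  have h := key Finset.univ
  simp only [Finset.mem_univ, if_true] at h
  exact h

end Polynomials

section Finite

/-- On a finite set one positive iterate of every injective self-map is the identity. -/
theorem exists_iterate_eq_self {Q : Type} [Finite Q] (N : Set Q) :
    ∃ m : ℕ, ∀ h : Q → Q, Set.MapsTo h N N → Set.InjOn h N → ∀ x ∈ N, h^[m + 1] x = x := by
  classical
  obtain ⟨m, hm⟩ : ∃ m, Nat.card (Equiv.Perm N) = m + 1 :=
    Nat.exists_eq_succ_of_ne_zero Nat.card_pos.ne'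
  refine ⟨m, fun h hmap hinj x hx => ?_⟩
  have hbij : Function.Bijective (hmap.restrict h N N) :=
    Finite.injective_iff_bijective.mp ((Set.MapsTo.restrict_inj hmap).mpr hinj)
  have hpow : ∀ (j : ℕ) (y : N), (((Equiv.ofBijective _ hbij) ^ j) y : Q) = h^[j] y := by
    intro j
    induction j with
    | zero => intro y; rfl
    | succ j ih =>
      intro y
      rw [pow_succ, Equiv.Perm.mul_apply, ih]
      rfl
  have := hpow (m + 1) ⟨x, hx⟩
  rw [← hm, pow_card_eq_one'] at this
  rw [← hm]
  exact this.symm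

theorem iterate_pres {Q : Type} {R : Set (Q × Q)} {f g : Q → Q}
    (h : ∀ x y, (x, y) ∈ R → (f x, g y) ∈ R) (m : ℕ) :
    ∀ x y, (x, y) ∈ R → (f^[m] x, g^[m] y) ∈ R := by
  induction m with
  | zero => exact fun _ _ h => h
  | succ m ih => exact fun x y hxy => ih _ _ (h _ _ hxy)

/-- A reflexive relation compatible with a finite quasigroup operation is an equivalence. -/
theorem symm_trans_of_quasigroup {Q : Type} [Finite Q] {N : Set Q} {R : Set (Q × Q)}
    (hrefl : ∀ x, (x, x) ∈ R) (f : Q → Q → Q) (hmap : ∀ x ∈ N, ∀ y ∈ N, f x y ∈ N)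
    (hl : ∀ x ∈ N, Set.InjOn (f x) N) (hr : ∀ y ∈ N, Set.InjOn (fun x => f x y) N)
    (hf : ∀ x x' y y', (x, x') ∈ R → (y, y') ∈ R → (f x y, f x' y') ∈ R) :
    (∀ u ∈ N, ∀ v ∈ N, (u, v) ∈ R → (v, u) ∈ R) ∧
      ∀ u ∈ N, ∀ v ∈ N, ∀ w ∈ N, (u, v) ∈ R → (v, w) ∈ R → (u, w) ∈ R := by
  obtain ⟨m, hm⟩ := exists_iterate_eq_self N
  set l : Q → Q → Q := fun x y => (f x)^[m] y with hl_def
  set r : Q → Q → Q := fun x z => (fun w => f w z)^[m] x with hr_def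
  have lmem : ∀ x ∈ N, ∀ y ∈ N, l x y ∈ N := fun x hx y hy =>
    Set.MapsTo.iterate (fun z hz => hmap x hx z hz) m hy
  have fl : ∀ x ∈ N, ∀ y ∈ N, f x (l x y) = y := fun x hx y hy => by
    have := hm (f x) (fun z hz => hmap x hx z hz) (hl x hx) y hy
    rwa [Function.iterate_succ_apply'] at this
  have fr : ∀ x ∈ N, ∀ z ∈ N, f (r x z) z = x := fun x hx z hz => by
    have := hm (fun w => f w z) (fun w hw => hmap w hw z hz) (hr z hz) x hx
    rwa [Function.iterate_succ_apply'] at this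
  have rf : ∀ x ∈ N, ∀ z ∈ N, r (f x z) z = x := fun x hx z hz => by
    have := hm (fun w => f w z) (fun w hw => hmap w hw z hz) (hr z hz) x hx
    rwa [Function.iterate_succ_apply] at this
  have lpres : ∀ x x' y y', (x, x') ∈ R → (y, y') ∈ R → (l x y, l x' y') ∈ R :=
    fun x x' y y' hx hy => iterate_pres (fun _ _ h => hf _ _ _ _ hx h) m _ _ hy
  have rpres : ∀ x x' y y', (x, x') ∈ R → (y, y') ∈ R → (r x y, r x' y') ∈ R :=
    fun x x' y y' hx hy => iterate_pres (R := R) (f := fun w => f w y) (g := fun w => f w y')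
      (fun _ _ h => hf _ _ _ _ h hy) m _ _ hx
  set d : Q → Q → Q → Q := fun x y z => f (r x (l y y)) (l y z) with hd_def
  have dpres : ∀ x x' y y' z z', (x, x') ∈ R → (y, y') ∈ R → (z, z') ∈ R →
      (d x y z, d x' y' z') ∈ R := fun x x' y y' z z' hx hy hz =>
    hf _ _ _ _ (rpres _ _ _ _ hx (lpres _ _ _ _ hy hy)) (lpres _ _ _ _ hy hz)
  have d1 : ∀ x ∈ N, ∀ z ∈ N, d x x z = z := fun x hx z hz => by
    have h : r x (l x x) = x := by
      have := rf x hx _ (lmem x hx x hx)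
      rwa [fl x hx x hx] at this
    change f (r x (l x x)) (l x z) = z
    rw [h, fl x hx z hz]
  have d2 : ∀ x ∈ N, ∀ y ∈ N, d x y y = x := fun x hx y hy =>
    fr x hx _ (lmem y hy y hy)
  refine ⟨fun u hu v hv h => ?_, fun u hu v hv w hw h h' => ?_⟩
  · have := dpres u u u v v v (hrefl u) h (hrefl v)
    rwa [d1 u hu v hv, d2 u hu v hv] at this
  · have := dpres u v v v v w h (hrefl v) h'
    rwa [d2 u hu v hv, d1 v hv w hw] at this

end Finite

section MinimalSets

variable {Q : Type} [SAlg S Q]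

/-- A minimal nonzero congruence lies in every equivalence relation that contains a
nontrivial reflexive subuniverse. -/
theorem subset_equivalence_of_minimal {μ : Set (Q × Q)}
    (hmin : ∀ θ : Set (Q × Q), IsCongruence S θ → (∃ x y, (x, y) ∈ θ ∧ x ≠ y) → μ ⊆ θ)
    {R : Set (Q × Q)} (hR : IsSubuniverse S R) (hrefl : ∀ x, (x, x) ∈ R)
    (hne : ∃ x y, (x, y) ∈ R ∧ x ≠ y) {E : Q → Q → Prop} (hE : Equivalence E)
    (hRE : ∀ x y, (x, y) ∈ R → E x y) {x y : Q} (h : (x, y) ∈ μ) : E x y := by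
  obtain ⟨a, b, hab, hne⟩ := hne
  have := hmin _ (isCongruence_eqvGen hR hrefl) ⟨a, b, Relation.EqvGen.rel _ _ hab, hne⟩ h
  exact (Equivalence.eqvGen_iff hE).mp (Relation.EqvGen.mono hRE _ _ this)

/-- The pairs `(g x, g y)` with `g` a unary polynomial form a subuniverse. -/
theorem isSubuniverse_uPoly_pairs (x y : Q) :
    IsSubuniverse S {p : Q × Q | ∃ g, UPoly S g ∧ p = (g x, g y)} := by
  intro o z hz
  choose g hg hz using hz
  refine ⟨_, UPoly.app o g hg, ?_⟩
  simp only [SAlg.interp, hz]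

/-- A nonconstant effect on a minimal congruence can be witnessed on any nontrivial pair. -/
theorem exists_uPoly_separating {μ : Set (Q × Q)}
    (hmin : ∀ θ : Set (Q × Q), IsCongruence S θ → (∃ x y, (x, y) ∈ θ ∧ x ≠ y) → μ ⊆ θ)
    {f : Q → Q} (hf : ∃ u v, (u, v) ∈ μ ∧ f u ≠ f v) {x y : Q} (hxy : x ≠ y) :
    ∃ g, UPoly S g ∧ f (g x) ≠ f (g y) := by
  by_contra! hcon
  obtain ⟨u, v, huv, hne⟩ := hf
  refine hne (subset_equivalence_of_minimal hmin (isSubuniverse_uPoly_pairs (S := S) x y)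
    (fun c => ⟨_, UPoly.const c, rfl⟩) ⟨x, y, ⟨_, UPoly.id, rfl⟩, hxy⟩
    (E := fun u v => f u = f v) ⟨fun _ => rfl, Eq.symm, Eq.trans⟩ ?_ huv)
  rintro p q ⟨g, hg, h⟩
  obtain ⟨rfl, rfl⟩ := Prod.mk.inj h
  exact hcon g hg

/-- Existence of a minimal set `e(Q)` for a minimal congruence `μ`. -/
theorem exists_minimal_idempotent [Finite Q] {μ : Set (Q × Q)} (hμ : IsCongruence S μ)
    (hμne : ∃ x y, (x, y) ∈ μ ∧ x ≠ y)
    (hmin : ∀ θ : Set (Q × Q), IsCongruence S θ → (∃ x y, (x, y) ∈ θ ∧ x ≠ y) → μ ⊆ θ) :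
    ∃ e : Q → Q, UPoly S e ∧ (∀ x, e (e x) = e x) ∧ (∃ x y, (x, y) ∈ μ ∧ e x ≠ e y) ∧
      ∀ p, UPoly S p → (∃ x y, (x, y) ∈ μ ∧ p (e x) ≠ p (e y)) →
        Set.InjOn p (Set.range e) := by
  classical
  have hex : ∃ n, ∃ f : Q → Q, UPoly S f ∧ (∃ x y, (x, y) ∈ μ ∧ f x ≠ f y) ∧
      (Set.range f).ncard = n := ⟨_, _, UPoly.id, hμne, rfl⟩
  obtain ⟨f, hf, hfne, hfn⟩ := Nat.find_spec hex
  have hle : ∀ p : Q → Q, UPoly S p → (∃ x y, (x, y) ∈ μ ∧ p x ≠ p y) →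
      (Set.range f).ncard ≤ (Set.range p).ncard := fun p hp hpne => by
    rw [hfn]; exact Nat.find_min' hex ⟨p, hp, hpne, rfl⟩
  have hinj : ∀ p : Q → Q, UPoly S p → (∃ x y, (x, y) ∈ μ ∧ p (f x) ≠ p (f y)) →
      Set.InjOn p (Set.range f) := fun p hp hpne => by
    have h := hle _ (hp.comp hf) hpne
    rw [← Set.ncard_image_iff (Set.toFinite _)]
    refine le_antisymm (Set.ncard_image_le (Set.toFinite _)) ?_
    rwa [show (Set.range fun x => p (f x)) = p '' Set.range f from Set.range_comp p f] at h
  obtain ⟨x, y, hxy, hne⟩ := hfne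
  obtain ⟨g, hg, hgne⟩ := exists_uPoly_separating (S := S) hmin ⟨x, y, hxy, hne⟩ hne
  obtain ⟨m, hm⟩ := exists_iterate_eq_self (Set.range f)
  have hfg : UPoly S fun x => f (g x) := hf.comp hg
  have hid := hm (fun x => f (g x)) (fun z _ => ⟨_, rfl⟩) (hinj _ hfg ⟨x, y, hxy, hgne⟩)
  have hmem : ∀ z, (fun x => f (g x))^[m + 1] z ∈ Set.range f := fun z => by
    rw [Function.iterate_succ_apply']; exact ⟨_, rfl⟩
  have hrange : Set.range (fun x => f (g x))^[m + 1] = Set.range f :=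
    Set.Subset.antisymm (by rintro _ ⟨z, rfl⟩; exact hmem z) fun z hz => ⟨z, hid z hz⟩
  refine ⟨_, hfg.iterate (m + 1), fun z => hid _ (hmem z), ⟨f x, f y, ?_, ?_⟩, ?_⟩
  · exact hf.mem_of_refl hμ.1 hμ.2.refl hxy
  · rwa [hid _ ⟨x, rfl⟩, hid _ ⟨y, rfl⟩]
  · rintro p hp ⟨u, v, huv, hpne⟩
    rw [hrange]
    obtain ⟨u', hu'⟩ := hmem u
    obtain ⟨v', hv'⟩ := hmem v
    rw [← hu', ← hv'] at hpne
    by_contra hnot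
    have hcol : ∀ x y, (x, y) ∈ μ → p (f x) = p (f y) := by
      intro x y hxy
      by_contra hxy'
      exact hnot (hinj p hp ⟨x, y, hxy, hxy'⟩)
    have hee : UPoly S (fun x => f (g x))^[m + 1] := hfg.iterate (m + 1)
    have h1 := hcol _ _ ((hg.comp (hfg.iterate m)).mem_of_refl hμ.1 hμ.2.refl huv)
    rw [hu', hv'] at hpne
    rw [Function.iterate_succ_apply', Function.iterate_succ_apply'] at hpne
    exact hpne h1

end MinimalSets

section Abelian

variable {Q : Type} [SAlg S Q]

/-- In a finite Taylor algebra with a minimal congruence `μ`, a nontrivial reflexive subuniverse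
`τ ⊆ μ` centralized by `μ` (as witnessed by `W`) meets every nontrivial reflexive subuniverse
of `μ` nontrivially. -/
theorem exists_common_pair [Finite Q] (hTay : IsTaylorAlg S Q) {μ : Set (Q × Q)}
    (hμ : IsCongruence S μ)
    (hmin : ∀ θ : Set (Q × Q), IsCongruence S θ → (∃ x y, (x, y) ∈ θ ∧ x ≠ y) → μ ⊆ θ)
    {τ : Set (Q × Q)} (hτ : IsSubuniverse S τ) (hτr : ∀ x, (x, x) ∈ τ) (hτμ : τ ⊆ μ)
    (hτne : ∃ x y, (x, y) ∈ τ ∧ x ≠ y)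
    {R : Set (Q × Q)} (hR : IsSubuniverse S R) (hRr : ∀ x, (x, x) ∈ R) (hRμ : R ⊆ μ)
    (hRne : ∃ x y, (x, y) ∈ R ∧ x ≠ y)
    {W : Set (Q × Q × Q × Q)} (hW : IsSubuniverse S W)
    (hWμ : ∀ x y, (x, y) ∈ μ → (x, x, y, y) ∈ W)
    (hWτ : ∀ x y, (x, y) ∈ τ → (x, y, x, y) ∈ W)
    (hWd : ∀ x y z w, (x, y, z, w) ∈ W → (x = y ↔ z = w)) :
    ∃ x y, (x, y) ∈ τ ∧ (x, y) ∈ R ∧ x ≠ y := by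
  classical
  have hWr : ∀ x, (x, x, x, x) ∈ W := fun x => hWμ x x (hμ.2.refl x)
  obtain ⟨x₀, y₀, hxy₀, hne₀⟩ := hτne
  obtain ⟨e, he, hee, hene, heinj⟩ :=
    exists_minimal_idempotent hμ ⟨x₀, y₀, hτμ hxy₀, hne₀⟩ hmin
  obtain ⟨g, hg, hgne⟩ := exists_uPoly_separating (S := S) hmin hene hne₀
  obtain ⟨a, b, ha, hb, habτ, hab⟩ : ∃ a b, e a = a ∧ e b = b ∧ (a, b) ∈ τ ∧ a ≠ b :=
    ⟨_, _, hee _, hee _, (he.comp hg).mem_of_refl hτ hτr hxy₀, hgne⟩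
  have habμ := hτμ habτ
  obtain ⟨n, t, u, v, -, huv, hidem, hid⟩ := hTay
  set N : Set Q := {x | e x = x ∧ (a, x) ∈ μ} with hN
  have haN : a ∈ N := ⟨ha, hμ.2.refl a⟩
  have hbN : b ∈ N := ⟨hb, habμ⟩
  have hNμ : ∀ x ∈ N, ∀ y ∈ N, (x, y) ∈ μ := fun x hx y hy =>
    hμ.2.trans (hμ.2.symm hx.2) hy.2
  have hpoly : ∀ (c : Fin n → Q) (i : Fin n),
      UPoly S fun x => e (t.eval (Function.update c i x)) := fun c i =>
    he.comp (UPoly.eval t (f := fun j x => Function.update c i x j) fun j => by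
      by_cases hj : j = i
      · subst hj; simpa using UPoly.id
      · simpa [hj] using UPoly.const (c j))
  let live : Fin n → Prop := fun i =>
    e (t.eval (Function.update (fun _ => a) i a)) ≠ e (t.eval (Function.update (fun _ => a) i b))
  have hlive : ∀ (c : Fin n → Q), (∀ j, c j ∈ N) → ∀ i, live i ↔
      e (t.eval (Function.update c i a)) ≠ e (t.eval (Function.update c i b)) := by
    intro c hc i
    refine not_congr (hWd _ _ _ _ (he.mem_of_refl_four hW hWr (t.eval_mem_four hW fun j => ?_)))
    by_cases hj : j = i
    · subst hj; simpa using hWτ a b habτ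
    · simpa [hj] using hWμ a (c j) (hc j).2
  have hinj : ∀ (c : Fin n → Q), (∀ j, c j ∈ N) → ∀ i, live i →
      Set.InjOn (fun x => e (t.eval (Function.update c i x))) N := by
    intro c hc i hi
    have hNe : N ⊆ Set.range e := fun x hx => ⟨x, hx.1⟩
    refine (heinj _ (hpoly c i) ⟨a, b, habμ, ?_⟩).mono hNe
    rw [ha, hb]
    exact (hlive c hc i).mp hi
  have hdead : ∀ (c : Fin n → Q), (∀ j, c j ∈ N) → ∀ i, ¬ live i → ∀ x ∈ N, ∀ y ∈ N,
      e (t.eval (Function.update c i x)) = e (t.eval (Function.update c i y)) := by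
    intro c hc i hi x hx y hy
    by_contra hxy
    refine (not_not.mp (mt (hlive c hc i).mpr hi) |> fun h => hab ?_)
    have hi' := heinj _ (hpoly c i) ⟨x, y, hNμ x hx y hy, by rwa [hx.1, hy.1]⟩
    exact hi' ⟨a, ha⟩ ⟨b, hb⟩ h
  have hagree : ∀ c c' : Fin n → Q, (∀ j, c j ∈ N) → (∀ j, c' j ∈ N) →
      (∀ j, live j → c j = c' j) → e (t.eval c) = e (t.eval c') := by
    intro c c' hc hc' hcc
    have key : ∀ s : Finset (Fin n),
        e (t.eval c) = e (t.eval fun j => if j ∈ s then c' j else c j) := by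
      intro s
      induction s using Finset.induction_on with
      | empty => simp
      | insert i s hi ih =>
        rw [ih]
        set q : Fin n → Q := fun j => if j ∈ s then c' j else c j with hq
        have hqN : ∀ j, q j ∈ N := fun j => by
          by_cases hj : j ∈ s
          · simpa [hq, hj] using hc' j
          · simpa [hq, hj] using hc j
        have h1 : (fun j => if j ∈ insert i s then c' j else c j) =
            Function.update q i (c' i) := by
          funext j
          by_cases hj : j = i
          · subst hj; simp
          · simp [hj, hq]
        have h2 : q = Function.update q i (c i) := by
          funext j
          by_cases hj : j = i
          · subst hj; simp [hq, hi]
          · simp [hj]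
        rw [h1]
        conv_lhs => rw [h2]
        by_cases hl : live i
        · rw [hcc i hl]
        · exact hdead q hqN i hl _ (hc i) _ (hc' i)
    simpa using key Finset.univ
  have hconst : ∀ x, e x = x → e (t.eval fun _ => x) = x := fun x hx => by
    rw [hidem, hx]
  obtain ⟨i, hi⟩ : ∃ i, live i := by
    by_contra! hno
    apply hab
    rw [← hconst a ha, ← hconst b hb]
    exact hagree _ _ (fun _ => haN) (fun _ => hbN) fun j hj => absurd hj (hno j)
  obtain ⟨j, hj, hij⟩ : ∃ j, live j ∧ j ≠ i := by
    by_contra! hno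
    have hproj : ∀ c : Fin n → Q, (∀ k, c k ∈ N) → e (t.eval c) = c i := fun c hc => by
      rw [hagree c (fun _ => c i) hc (fun _ => hc i) fun k hk => by rw [hno k hk]]
      exact hconst _ (hc i).1
    have hN2 : ∀ w : Fin n → Fin 2, ∀ k, (if w k = 0 then a else b) ∈ N := fun w k => by
      split_ifs
      exacts [haN, hbN]
    have h := congrArg e (hid i a b)
    rw [hproj _ (hN2 (u i)), hproj _ (hN2 (v i))] at h
    have := huv i
    split_ifs at h with h1 h2 h2
    · exact this (h1.trans h2.symm)
    · exact hab h
    · exact hab h.symm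
    · omega
  set f : Q → Q → Q := fun x y =>
    e (t.eval (Function.update (Function.update (fun _ => a) i x) j y)) with hf
  have hupd : ∀ (c : Fin n → Q), (∀ k, c k ∈ N) → ∀ k, ∀ x ∈ N, ∀ l,
      Function.update c k x l ∈ N := fun c hc k x hx l => by
    by_cases hl : l = k
    · subst hl; simpa using hx
    · simpa [hl] using hc l
  have hsub : ∀ {R : Set (Q × Q)}, IsSubuniverse S R → (∀ x, (x, x) ∈ R) →
      ∀ x x' y y', (x, x') ∈ R → (y, y') ∈ R → (f x y, f x' y') ∈ R := by
    intro R hR hRr x x' y y' hx hy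
    refine he.mem_of_refl hR hRr (t.eval_mem_two hR fun k => ?_)
    by_cases hk : k = j
    · subst hk; simpa using hy
    · by_cases hk' : k = i
      · subst hk'; simpa [hk] using hx
      · simpa [hk, hk'] using hRr a
  have hfa : f a a = a := by
    simpa [hf] using hconst a ha
  obtain ⟨hsymm, htrans⟩ := symm_trans_of_quasigroup (N := N) hRr f
    (fun x hx y hy => ⟨hee _, by
      have := hsub hμ.1 hμ.2.refl a x a y hx.2 hy.2
      rwa [hfa] at this⟩)
    (fun x hx => hinj _ (hupd _ (fun _ => haN) i x hx) j hj)
    (fun y hy => by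
      have := hinj _ (hupd (fun _ => a) (fun _ => haN) j y hy) i hi
      simpa only [hf, Function.update_comm hij] using this)
    (hsub hR hRr)
  have heN : ∀ x, (a, x) ∈ μ → e x ∈ N := fun x hx => ⟨hee x, by
    have := he.mem_of_refl hμ.1 hμ.2.refl hx
    rwa [ha] at this⟩
  have hE := subset_equivalence_of_minimal hmin hR hRr hRne
    (E := fun x y => (x, y) ∈ μ ∧ ((a, x) ∈ μ → (e x, e y) ∈ R))
    ⟨fun x => ⟨hμ.2.refl x, fun _ => hRr _⟩,
      fun {x y} h => ⟨hμ.2.symm h.1, fun hy =>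
        have hx := hμ.2.trans hy (hμ.2.symm h.1)
        hsymm _ (heN x hx) _ (heN y hy) (h.2 hx)⟩,
      fun {x y z} h h' => ⟨hμ.2.trans h.1 h'.1, fun hx =>
        have hy := hμ.2.trans hx h.1
        have hz := hμ.2.trans hy h'.1
        htrans _ (heN x hx) _ (heN y hy) _ (heN z hz) (h.2 hx) (h'.2 hy)⟩⟩
    (fun x y h => ⟨hRμ h, fun _ => he.mem_of_refl hR hRr h⟩) habμ
  have habR := hE.2 (hμ.2.refl a)
  rw [ha, hb] at habR
  exact ⟨a, b, habτ, habR, hab⟩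

end Abelian

section Quotient

variable {A : Type} [SAlg S A]

/-- The quotient algebra by a setoid, computed on chosen representatives. -/
@[reducible] noncomputable def setoidAlg (S : Signature) {A : Type} [SAlg S A] (r : Setoid A) :
    SAlg S (Quotient r) :=
  ⟨fun o x => Quotient.mk r (SAlg.interp o fun i => (x i).out)⟩

/-- Passing to the quotient by `ρ` in `exists_common_pair`. -/
theorem exists_common_pair_mod [Finite A] (hTay : IsTaylorAlg S A) {ρ ρplus : Set (A × A)}
    (hρ : MeetIrredWith S ρ ρplus) {τ R : Set (A × A)}
    (hτ : IsSubuniverse S τ) (hτs : Saturated ρ τ) (hρτ : ρ ⊂ τ) (hτμ : τ ⊆ ρplus)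
    (hR : IsSubuniverse S R) (hRs : Saturated ρ R) (hρR : ρ ⊂ R) (hRμ : R ⊆ ρplus)
    {W : Set (A × A × A × A)} (hW : IsSubuniverse S W)
    (hWμ : ∀ x y, (x, y) ∈ ρplus → (x, x, y, y) ∈ W)
    (hWτ : ∀ x y, (x, y) ∈ τ → (x, y, x, y) ∈ W)
    (hWd : ∀ x y z w, (x, y, z, w) ∈ W → ((x, y) ∈ ρ ↔ (z, w) ∈ ρ)) :
    ∃ x y, (x, y) ∈ τ ∧ (x, y) ∈ R ∧ (x, y) ∉ ρ := by
  obtain ⟨hρc, -, hμc, hρμ, hρmin⟩ := hρ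
  let r : Setoid A := ⟨fun a b => (a, b) ∈ ρ, hρc.2⟩
  let _ : SAlg S (Quotient r) := setoidAlg S r
  have hmk : ∀ {x y : A}, Quotient.mk r x = Quotient.mk r y ↔ (x, y) ∈ ρ :=
    fun {x y} => Quotient.eq (r := r)
  have hhom : ∀ (o : S.ops) (x : Fin (S.arity o) → A),
      SAlg.interp o (fun i => Quotient.mk r (x i)) = Quotient.mk r (SAlg.interp o x) :=
    fun o x => hmk.mpr (hρc.1 o (fun i => ((Quotient.mk r (x i)).out, x i)) fun i =>
      hmk.mp (Quotient.out_eq _))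
  have heval : ∀ {n : ℕ} (t : STerm S n) (x : Fin n → A),
      t.eval (fun i => Quotient.mk r (x i)) = Quotient.mk r (t.eval x) := by
    intro n t x
    induction t with
    | var i => rfl
    | app o ts ih => simp only [STerm.eval, ih, hhom]
  let m2 : A × A → Quotient r × Quotient r := fun p => (Quotient.mk r p.1, Quotient.mk r p.2)
  let m4 : A × A × A × A → Quotient r × Quotient r × Quotient r × Quotient r :=
    fun p => (Quotient.mk r p.1, Quotient.mk r p.2.1, Quotient.mk r p.2.2.1,
      Quotient.mk r p.2.2.2)
  have hsub2 : ∀ {L : Set (A × A)}, IsSubuniverse S L → IsSubuniverse S (m2 '' L) := by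
    intro L hL o z hz
    choose y hy hyz using hz
    refine ⟨_, hL o y hy, ?_⟩
    have : z = fun i => m2 (y i) := funext fun i => (hyz i).symm
    rw [this]
    exact Prod.ext (hhom o _).symm (hhom o _).symm
  have hsub4 : IsSubuniverse S (m4 '' W) := by
    intro o z hz
    choose y hy hyz using hz
    refine ⟨_, hW o y hy, ?_⟩
    have : z = fun i => m4 (y i) := funext fun i => (hyz i).symm
    rw [this]
    exact Prod.ext (hhom o _).symm (Prod.ext (hhom o _).symm
      (Prod.ext (hhom o _).symm (hhom o _).symm))
  have hrefl2 : ∀ {L : Set (A × A)}, ρ ⊂ L → ∀ x, (x, x) ∈ m2 '' L := fun hL x => by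
    induction x using Quotient.ind with
    | _ x => exact ⟨(x, x), hL.1 (hρc.2.refl x), rfl⟩
  have hne2 : ∀ {L : Set (A × A)}, ρ ⊂ L → ∃ x y, (x, y) ∈ m2 '' L ∧ x ≠ y := fun hL => by
    obtain ⟨p, hp, hpρ⟩ := Set.exists_of_ssubset hL
    exact ⟨_, _, ⟨p, hp, rfl⟩, fun h => hpρ (hmk.mp h)⟩
  have hsat : ∀ {L : Set (A × A)}, Saturated ρ L → ∀ x y,
      (Quotient.mk r x, Quotient.mk r y) ∈ m2 '' L → (x, y) ∈ L := by
    rintro L hL x y ⟨⟨x', y'⟩, hp, h⟩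
    obtain ⟨h1, h2⟩ := Prod.mk.inj h
    rw [← hL]
    exact ⟨x', hmk.mp h1.symm, y', hp, hmk.mp h2⟩
  have hμsat : Saturated ρ ρplus := by
    refine Set.Subset.antisymm ?_ fun p hp => ⟨p.1, hρc.2.refl _, p.2, hp, hρc.2.refl _⟩
    rintro p ⟨x, hx, y, hxy, hy⟩
    exact hμc.2.trans (hρμ.1 hx) (hμc.2.trans hxy (hρμ.1 hy))
  have hTayQ : IsTaylorAlg S (Quotient r) := by
    obtain ⟨n, t, u, v, hn, huv, hidem, hid⟩ := hTay
    refine ⟨n, t, u, v, hn, huv, fun x => ?_, fun i x y => ?_⟩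
    · induction x using Quotient.ind with
      | _ x => rw [heval t fun _ => x, hidem]
    · induction x using Quotient.ind with
      | _ x =>
        induction y using Quotient.ind with
        | _ y =>
          have := congrArg (Quotient.mk r) (hid i x y)
          rw [← heval, ← heval] at this
          simpa only [apply_ite (Quotient.mk r)] using this
  have hμQ : IsCongruence S (m2 '' ρplus) := by
    refine ⟨hsub2 hμc.1, ⟨hrefl2 hρμ, ?_, ?_⟩⟩
    · rintro x y ⟨p, hp, h⟩
      obtain ⟨rfl, rfl⟩ := Prod.mk.inj h
      exact ⟨(p.2, p.1), hμc.2.symm hp, rfl⟩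
    · intro x y z
      induction x using Quotient.ind with
      | _ x =>
        induction y using Quotient.ind with
        | _ y =>
          induction z using Quotient.ind with
          | _ z =>
            intro h h'
            exact ⟨(x, z), hμc.2.trans (hsat hμsat _ _ h) (hsat hμsat _ _ h'), rfl⟩
  have hminQ : ∀ θ : Set (Quotient r × Quotient r), IsCongruence S θ →
      (∃ x y, (x, y) ∈ θ ∧ x ≠ y) → m2 '' ρplus ⊆ θ := by
    rintro θ hθ ⟨x, y, hxy, hne⟩
    have hpre : ρplus ⊆ m2 ⁻¹' θ := by
      refine hρmin _ ⟨fun o z hz => ?_, ⟨fun x => hθ.2.refl _, fun h => hθ.2.symm h,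
        fun h h' => hθ.2.trans h h'⟩⟩ ?_
      · have := hθ.1 o (fun i => m2 (z i)) hz
        rwa [show SAlg.interp o (fun i => m2 (z i)) = m2 (SAlg.interp o z) from
          Prod.ext (hhom o _) (hhom o _)] at this
      · refine Set.ssubset_iff_subset_ne.mpr ⟨fun p hp => ?_, fun h => ?_⟩
        · change (Quotient.mk r p.1, Quotient.mk r p.2) ∈ θ
          rw [hmk.mpr hp]
          exact hθ.2.refl _
        · induction x using Quotient.ind with
          | _ x =>
            induction y using Quotient.ind with
            | _ y =>
              have : (x, y) ∈ m2 ⁻¹' θ := hxy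
              rw [← h] at this
              exact hne (hmk.mpr this)
    rintro _ ⟨p, hp, rfl⟩
    exact hpre hp
  obtain ⟨x, y, hxτ, hxR, hne⟩ := exists_common_pair (W := m4 '' W) hTayQ hμQ hminQ
    (hsub2 hτ) (hrefl2 hρτ) (Set.image_mono hτμ) (hne2 hρτ)
    (hsub2 hR) (hrefl2 hρR) (Set.image_mono hRμ) (hne2 hρR) hsub4
    (by
      rintro x y ⟨p, hp, h⟩
      obtain ⟨rfl, rfl⟩ := Prod.mk.inj h
      exact ⟨_, hWμ _ _ hp, rfl⟩)
    (by
      rintro x y ⟨p, hp, h⟩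
      obtain ⟨rfl, rfl⟩ := Prod.mk.inj h
      exact ⟨_, hWτ _ _ hp, rfl⟩)
    (by
      rintro x y z w ⟨p, hp, h⟩
      simp only [m4, Prod.mk.injEq] at h
      obtain ⟨rfl, rfl, rfl, rfl⟩ := h
      rw [hmk, hmk]
      exact hWd _ _ _ _ hp)
  induction x using Quotient.ind with
  | _ x =>
    induction y using Quotient.ind with
    | _ y =>
      exact ⟨x, y, hsat hτs _ _ hxτ, hsat hRs _ _ hxR, fun h => hne (hmk.mpr h)⟩

end Quotient

section Bridges

variable {A : Type} [SAlg S A]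

theorem IsBridgeLR.comp {ρ σ θ L M N : Set (A × A)} {T T' : Set (A × A × A × A)}
    (hT : IsBridgeLR S ρ σ L M T) (hT' : IsBridgeLR S σ θ M N T') :
    IsBridgeLR S ρ θ L N (bComp T T') := by
  obtain ⟨⟨h1, h2, h3, h4, h5, h6⟩, hL, hM⟩ := hT
  obtain ⟨⟨k1, k2, k3, k4, k5, k6⟩, kM, kN⟩ := hT'
  have hpr : pr12 (bComp T T') = L := by
    refine Set.Subset.antisymm ?_ ?_
    · rintro ⟨a, a'⟩ ⟨c, c', b, b', h, -⟩
      rw [← hL]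
      exact ⟨b, b', h⟩
    · rw [← hL]
      rintro ⟨a, a'⟩ ⟨b, b', h⟩
      have hb : (b, b') ∈ pr12 T' := by rw [kM, ← hM]; exact ⟨a, a', h⟩
      obtain ⟨c, c', h'⟩ := hb
      exact ⟨c, c', b, b', h, h'⟩
  have hpr' : pr34 (bComp T T') = N := by
    refine Set.Subset.antisymm ?_ ?_
    · rintro ⟨c, c'⟩ ⟨a, a', b, b', -, h⟩
      rw [← kN]
      exact ⟨b, b', h⟩
    · rw [← kN]
      rintro ⟨c, c'⟩ ⟨b, b', h⟩
      have hb : (b, b') ∈ pr34 T := by rw [hM, ← kM]; exact ⟨c, c', h⟩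
      obtain ⟨a, a', h'⟩ := hb
      exact ⟨a, a', b, b', h', h⟩
  refine ⟨⟨?_, ?_, ?_, ?_, ?_, ?_⟩, hpr, hpr'⟩
  · intro o x hx
    choose b b' hb hb' using hx
    exact ⟨_, _, h1 o (fun i => ((x i).1, (x i).2.1, b i, b' i)) hb,
      k1 o (fun i => (b i, b' i, (x i).2.2.1, (x i).2.2.2)) hb'⟩
  · rintro a₁ a₂ c₁ c₂ a₁' a₂' ⟨b, b', h, h'⟩ r1 r2
    exact ⟨b, b', h2 _ _ _ _ _ _ h r1 r2, h'⟩
  · rintro a₁ a₂ c₁ c₂ c₁' c₂' ⟨b, b', h, h'⟩ r1 r2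
    exact ⟨b, b', h, k3 _ _ _ _ _ _ h' r1 r2⟩
  · rwa [hpr, ← hL]
  · rwa [hpr', ← kN]
  · rintro a₁ a₂ c₁ c₂ ⟨b, b', h, h'⟩
    exact (h6 _ _ _ _ h).trans (k6 _ _ _ _ h')

theorem IsBridgeLR.conv {ρ σ L M : Set (A × A)} {T : Set (A × A × A × A)}
    (hT : IsBridgeLR S ρ σ L M T) : IsBridgeLR S σ ρ M L (bConv T) := by
  obtain ⟨⟨h1, h2, h3, h4, h5, h6⟩, hL, hM⟩ := hT
  exact ⟨⟨fun o x hx => h1 o (fun i => ((x i).2.2.1, (x i).2.2.2, (x i).1, (x i).2.1)) hx,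
    fun _ _ _ _ _ _ h => h3 _ _ _ _ _ _ h, fun _ _ _ _ _ _ h => h2 _ _ _ _ _ _ h, h5, h4,
    fun _ _ _ _ h => (h6 _ _ _ _ h).symm⟩, hM, hL⟩

theorem btr_bComp {T T' : Set (A × A × A × A)} {a b c : A} (hab : (a, b) ∈ btr T)
    (hbc : (b, c) ∈ btr T') : (a, c) ∈ btr (bComp T T') :=
  ⟨b, b, hab, hbc⟩

/-- A maximal trace contains every trace of a reflexive bridge with the same anchors. -/
theorem IsOptOf.subset {ρ L γ δ : Set (A × A)} (h : IsOptOf S ρ L γ) (hδ : δ ∈ refTr S ρ L) :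
    δ ⊆ γ := by
  obtain ⟨T, hT, hr, rfl⟩ := h.1
  obtain ⟨T', hT', hr', rfl⟩ := hδ
  have := h.2 (btr (bComp T T'))
    ⟨_, hT.comp hT', fun a => btr_bComp (hr a) (hr' a), rfl⟩
    fun p hp => btr_bComp hp (hr' p.2)
  rw [← this]
  exact fun p hp => btr_bComp (hr p.1) hp

theorem IsOptOf.unique {ρ L γ δ : Set (A × A)} (h : IsOptOf S ρ L γ) (h' : IsOptOf S ρ L δ) :
    γ = δ :=
  Set.Subset.antisymm (h'.subset h.1) (h.subset h'.1)

theorem IsOptOf.subset_trace {ρ L γ : Set (A × A)}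
    (h : IsOptOf S ρ L γ) : ρ ⊆ γ := by
  obtain ⟨T, hT, hr, rfl⟩ := h.1
  exact fun p hp => hT.1.2.2.1 _ _ _ _ _ _ (hr p.1) hp hp

theorem IsOptOf.isCongruence {ρ L γ : Set (A × A)} (h : IsOptOf S ρ L γ) :
    IsCongruence S γ := by
  obtain ⟨T, hT, hr, rfl⟩ := h.1
  refine ⟨fun o x hx => hT.1.1 o _ hx, hr, fun {x y} hxy => ?_, fun {x y z} hxy hyz => ?_⟩
  · exact h.subset ⟨bConv T, hT.conv, hr, rfl⟩ hxy
  · exact h.subset ⟨bComp T T, hT.comp hT, fun a => btr_bComp (hr a) (hr a), rfl⟩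
      (btr_bComp hxy hyz)

/-- A nontrivial optimal trace forces `Cov⁺(ρ)` to be a singleton. -/
theorem IsOptOf.covPlus_eq [Finite A] (hTay : IsTaylorAlg S A) {ρ ρplus τ τ' γ : Set (A × A)}
    (hρ : MeetIrredWith S ρ ρplus) (hτ : τ ∈ CovPlus S ρ ρplus) (hτ' : τ' ∈ CovPlus S ρ ρplus)
    (h : IsOptOf S ρ τ γ) (hne : γ ≠ ρ) : τ = τ' := by
  have hμγ : ρplus ⊆ γ := hρ.2.2.2.2 γ h.isCongruence
    (Set.ssubset_iff_subset_ne.mpr ⟨h.subset_trace, hne.symm⟩)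
  obtain ⟨T, hT, hr, rfl⟩ := h.1
  have hW := hT.comp hT.conv
  obtain ⟨⟨h1, h2, h3, h4⟩, h5⟩ := hτ
  obtain ⟨⟨k1, k2, k3, k4⟩, k5⟩ := hτ'
  obtain ⟨x, y, hxτ, hxτ', hxρ⟩ := exists_common_pair_mod hTay hρ h1 h2 h3 h5 k1 k2 k3 k5
    hW.1.1 (fun x y hxy => btr_bComp (T' := bConv T) (hμγ hxy) (hr y))
    (fun x y hxy => by
      rw [← hT.2.1] at hxy
      obtain ⟨b, b', hb⟩ := hxy
      exact ⟨b, b', hb, hb⟩)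
    hW.1.2.2.2.2.2
  have hinter : IsSubuniverse S (τ ∩ τ') := fun o z hz =>
    ⟨h1 o z fun i => (hz i).1, k1 o z fun i => (hz i).2⟩
  have hsat : Saturated ρ (τ ∩ τ') := by
    refine Set.Subset.antisymm ?_ fun p hp =>
      ⟨p.1, hρ.1.2.refl _, p.2, hp, hρ.1.2.refl _⟩
    rintro p ⟨u, hu, v, huv, hv⟩
    exact ⟨h2 ▸ ⟨u, hu, v, huv.1, hv⟩, k2 ▸ ⟨u, hu, v, huv.2, hv⟩⟩
  have hss : ρ ⊂ τ ∩ τ' :=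
    ⟨Set.subset_inter h3.1 k3.1, fun hle => hxρ (hle ⟨hxτ, hxτ'⟩)⟩
  rw [← h4 _ hinter hsat hss Set.inter_subset_left]
  exact k4 _ hinter hsat hss Set.inter_subset_right

/-- The optimal trace does not depend on the choice of the anchor in `Cov⁺(ρ)`. -/
theorem IsOptOf.eq_of_covPlus [Finite A] (hTay : IsTaylorAlg S A)
    {ρ ρplus τ τ' γ γ' : Set (A × A)} (hρ : MeetIrredWith S ρ ρplus)
    (hτ : τ ∈ CovPlus S ρ ρplus) (hτ' : τ' ∈ CovPlus S ρ ρplus)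
    (h : IsOptOf S ρ τ γ) (h' : IsOptOf S ρ τ' γ') : γ = γ' := by
  by_cases hγ : γ = ρ
  · by_cases hγ' : γ' = ρ
    · rw [hγ, hγ']
    · obtain rfl := h'.covPlus_eq hTay hρ hτ' hτ hγ'
      exact h.unique h'
  · obtain rfl := h.covPlus_eq hTay hρ hτ hτ' hγ
    exact h.unique h'

theorem exists_isOptOf [Finite A] {ρ L : Set (A × A)} (hne : (refTr S ρ L).Nonempty) :
    ∃ γ, IsOptOf S ρ L γ := by
  obtain ⟨γ, hγ⟩ := (Set.toFinite (refTr S ρ L)).exists_maximal hne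
  exact ⟨γ, hγ.prop, fun δ hδ h => Set.Subset.antisymm (hγ.le_of_ge hδ h) h⟩

/-- Optimal traces grow along reflexive bridges. -/
theorem IsOptOf.subset_of_bridge {ρ σ L M γ γ' : Set (A × A)} {T : Set (A × A × A × A)}
    (hT : IsBridgeLR S ρ σ L M T) (hr : ReflBridge T) (h : IsOptOf S ρ L γ)
    (h' : IsOptOf S σ M γ') : γ' ⊆ γ := by
  obtain ⟨T', hT', hr', rfl⟩ := h'.1
  have hsub : btr T' ⊆ btr (bComp T (bComp T' (bConv T))) := fun p hp =>
    btr_bComp (hr p.1) (btr_bComp (T' := bConv T) hp (hr p.2))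
  exact hsub.trans (h.subset ⟨_, hT.comp (hT'.comp hT.conv), fun a => hsub (hr' a), rfl⟩)

end Bridges

end Zhuk

/-- adjacent meet-irreducible congruences of a finite Taylor algebra
(i.e., joined by a reflexive good bridge) have the same `Opt`. -/
theorem stmt_8 {S : Zhuk.Signature} {A : Type} [Zhuk.SAlg S A] [Finite A]
    (hTay : Zhuk.IsTaylorAlg S A)
    (ρ ρplus σ σplus : Set (A × A))
    (hρ : Zhuk.MeetIrredWith S ρ ρplus) (hσ : Zhuk.MeetIrredWith S σ σplus)
    (T : Set (A × A × A × A)) (hT : Zhuk.GoodBridge S ρ ρplus σ σplus T)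
    (href : Zhuk.ReflBridge T) :
    ∀ τ ∈ Zhuk.CovPlus S ρ ρplus, ∀ τ' ∈ Zhuk.CovPlus S σ σplus,
      ∀ γ γ' : Set (A × A), Zhuk.IsOptOf S ρ τ γ → Zhuk.IsOptOf S σ τ' γ' → γ = γ' := by
  intro τ hτ τ' hτ' γ γ' hγ hγ'
  obtain ⟨-, τ₀, hτ₀, τ₀', hτ₀', T', -, hT', htr⟩ := hT
  have hr : Zhuk.ReflBridge T' := fun a => htr ▸ href a
  obtain ⟨δ, hδ⟩ := Zhuk.exists_isOptOf (S := S) (ρ := ρ) (L := τ₀)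
    ⟨_, _, hT'.comp hT'.conv, fun a => Zhuk.btr_bComp (T' := Zhuk.bConv T') (hr a) (hr a), rfl⟩
  obtain ⟨δ', hδ'⟩ := Zhuk.exists_isOptOf (S := S) (ρ := σ) (L := τ₀')
    ⟨_, _, hT'.conv.comp hT', fun a => Zhuk.btr_bComp (T := Zhuk.bConv T') (hr a) (hr a), rfl⟩
  rw [hγ.eq_of_covPlus hTay hρ hτ hτ₀ hδ, hγ'.eq_of_covPlus hTay hσ hτ' hτ₀' hδ']
  exact Set.Subset.antisymm
    (Zhuk.IsOptOf.subset_of_bridge hT'.conv hr hδ' hδ)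
    (Zhuk.IsOptOf.subset_of_bridge hT' hr hδ hδ')
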